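/- arXiv:1309.1115 — 2 statements merged into one kernel-verified Lean document; each statement's English description precedes it below -/
import Mathlib

section
/- Let H and K be complex Hilbert spaces and let α be a star-algebra isomorphism from the algebra of compact operators on H onto the algebra of compact operators on K (a bijective linear map that preserves products and adjoints). Then there exists a unitary operator U : H → K such that α(T) = U ∘ T ∘ U⁻¹ for every compact operator T on H. -/
open InnerProductSpace in
theorem InnerProductSpace.isCompactOperator_rankOne {𝕜 E F : Type*} [RCLike 𝕜]
    [NormedAddCommGroup E] [InnerProductSpace 𝕜 E] [NormedAddCommGroup F] [InnerProductSpace 𝕜 F]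
    (x : E) (y : F) : IsCompactOperator ⇑(rankOne 𝕜 x y) := by
  have h : IsCompactOperator ⇑(ContinuousLinearMap.toSpanSingleton 𝕜 x) :=
    isCompactOperator_of_locallyCompactSpace_rng (ContinuousLinearMap.toSpanSingleton 𝕜 x)
  exact h.comp_clm (innerSL 𝕜 y)

open InnerProductSpace in
/-- A self-adjoint idempotent `q ≠ 0` such that `q S q` is a multiple of `q` for every rank-one
operator `S` is the orthogonal projection onto a line. -/
theorem IsStarProjection.exists_eq_rankOne_self {K : Type*} [NormedAddCommGroup K]
    [InnerProductSpace ℂ K] [CompleteSpace K] {q : K →L[ℂ] K} (hq : IsStarProjection q)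
    (hq0 : q ≠ 0) (hmin : ∀ k l : K, ∃ c : ℂ, q * rankOne ℂ k l * q = c • q) :
    ∃ f : K, ‖f‖ = 1 ∧ q = rankOne ℂ f f := by
  obtain ⟨k, hk⟩ : ∃ k, q k ≠ 0 := by
    by_contra! h
    exact hq0 (ContinuousLinearMap.ext h)
  set f : K := ((‖q k‖ : ℂ)⁻¹) • q k with hf
  have hnorm : ‖f‖ = 1 := by simp [hf, norm_smul, hk]
  have hqf : q f = f := by
    have : q (q k) = q k := DFunLike.congr_fun hq.isIdempotentElem.eq k
    rw [hf, map_smul, this]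
  have hcorner : q * rankOne ℂ f f * q = rankOne ℂ f f := by
    rw [ContinuousLinearMap.mul_def, ContinuousLinearMap.mul_def, comp_rankOne, rankOne_comp, hqf,
      ← ContinuousLinearMap.star_eq_adjoint, hq.isSelfAdjoint.star_eq, hqf]
  obtain ⟨c, hc⟩ := hmin f f
  rw [hcorner] at hc
  have hcf : f = c • f := by simpa [hqf, hnorm] using DFunLike.congr_fun hc f
  have hf0 : f ≠ 0 := norm_ne_zero_iff.mp (by simp [hnorm])
  have hc1 : c = 1 := smul_left_injective ℂ hf0 (by simpa using hcf.symm)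
  exact ⟨f, hnorm, by simp [hc, hc1]⟩

open InnerProductSpace in

/-- Every star-algebra isomorphism between the algebras of compact operators
on complex Hilbert spaces `H` and `K` is implemented by a unitary `U : H → K`
(a surjective linear isometry), i.e. `α T = U ∘ T ∘ U⁻¹` for every compact `T`.
The isomorphism `α` is encoded as a map on bounded operators that restricts to a
bijective, linear, multiplicative, star-preserving map from the compact operators on `H`
onto the compact operators on `K`. -/
theorem compact_star_iso_spatially_implemented
    {H K : Type*} [NormedAddCommGroup H] [InnerProductSpace ℂ H] [CompleteSpace H]
    [NormedAddCommGroup K] [InnerProductSpace ℂ K] [CompleteSpace K]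
    (α : (H →L[ℂ] H) → (K →L[ℂ] K))
    (hcompact : ∀ T : H →L[ℂ] H, IsCompactOperator ⇑T → IsCompactOperator ⇑(α T))
    (hadd : ∀ T S : H →L[ℂ] H, IsCompactOperator ⇑T → IsCompactOperator ⇑S →
      α (T + S) = α T + α S)
    (hsmul : ∀ (c : ℂ) (T : H →L[ℂ] H), IsCompactOperator ⇑T → α (c • T) = c • α T)
    (hmul : ∀ T S : H →L[ℂ] H, IsCompactOperator ⇑T → IsCompactOperator ⇑S →
      α (T * S) = α T * α S)
    (hstar : ∀ T : H →L[ℂ] H, IsCompactOperator ⇑T → α (star T) = star (α T))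
    (hinj : ∀ T S : H →L[ℂ] H, IsCompactOperator ⇑T → IsCompactOperator ⇑S →
      α T = α S → T = S)
    (hsurj : ∀ S : K →L[ℂ] K, IsCompactOperator ⇑S →
      ∃ T : H →L[ℂ] H, IsCompactOperator ⇑T ∧ α T = S) :
    ∃ U : H ≃ₗᵢ[ℂ] K, ∀ T : H →L[ℂ] H, IsCompactOperator ⇑T →
      ∀ k : K, α T k = U (T (U.symm k)) := by
  have hr (x y : H) : IsCompactOperator ⇑(rankOne ℂ x y) := isCompactOperator_rankOne x y
  have hmul_compact {S T : H →L[ℂ] H} (hT : IsCompactOperator ⇑T) :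
      IsCompactOperator ⇑(S * T) := hT.clm_comp S
  have h0 : IsCompactOperator ⇑(0 : H →L[ℂ] H) := isCompactOperator_zero
  have hα0 : α 0 = 0 := by simpa using hsmul 0 0 h0
  rcases subsingleton_or_nontrivial H with hH | hH
  · have hK : Subsingleton K := by
      refine subsingleton_of_forall_eq 0 fun k ↦ ?_
      obtain ⟨T, -, hT⟩ := hsurj _ (isCompactOperator_rankOne k k)
      rw [Subsingleton.elim T 0, hα0] at hT
      simpa using (congrArg norm hT).symm
    let V : H →ₗᵢ[ℂ] K := ⟨0, fun x ↦ by simp [Subsingleton.elim x 0]⟩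
    exact ⟨.ofSurjective V fun k ↦ ⟨0, Subsingleton.elim _ _⟩, fun _ _ _ ↦ Subsingleton.elim _ _⟩
  obtain ⟨e, he⟩ := exists_norm_eq H zero_le_one
  have hp := isStarProjection_rankOne_self (𝕜 := ℂ) he
  obtain ⟨f, hf, hq⟩ : ∃ f : K, ‖f‖ = 1 ∧ α (rankOne ℂ e e) = rankOne ℂ f f := by
    refine IsStarProjection.exists_eq_rankOne_self ⟨?_, ?_⟩ ?_ ?_
    · rw [IsIdempotentElem, ← hmul _ _ (hr e e) (hr e e), hp.isIdempotentElem.eq]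
    · rw [IsSelfAdjoint, ← hstar _ (hr e e), hp.isSelfAdjoint.star_eq]
    · intro h
      have h' := hinj _ _ (hr e e) h0 (h.trans hα0.symm)
      simpa [he] using congrArg norm h'
    · intro k l
      obtain ⟨T, hT, hTα⟩ := hsurj _ (isCompactOperator_rankOne k l)
      refine ⟨inner ℂ e (T e), ?_⟩
      rw [← hTα, mul_assoc, ← hmul _ _ hT (hr e e), ← hmul _ _ (hr e e) (hmul_compact (hr e e)),
        ← hsmul _ _ (hr e e)]
      congr 1
      rw [ContinuousLinearMap.mul_def, ContinuousLinearMap.mul_def, comp_rankOne,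
        rankOne_comp_rankOne]
  have hqf : α (rankOne ℂ e e) f = f := by simp [hq, hf]
  let L : H →ₗ[ℂ] K :=
    { toFun x := α (rankOne ℂ x e) f
      map_add' x y := by simp [hadd _ _ (hr x e) (hr y e)]
      map_smul' c x := by simp [hsmul _ _ (hr x e)] }
  have hinner (x y : H) : inner ℂ (L x) (L y) = inner ℂ x y := by
    change inner ℂ (α (rankOne ℂ x e) f) (α (rankOne ℂ y e) f) = _
    rw [← ContinuousLinearMap.adjoint_inner_right, ← ContinuousLinearMap.star_eq_adjoint,
      ← hstar _ (hr x e), ← mul_apply_eq_comp, ContinuousLinearMap.star_eq_adjoint,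
      adjoint_rankOne, ← hmul _ _ (hr e x) (hr y e), ContinuousLinearMap.mul_def,
      rankOne_comp_rankOne, hsmul _ _ (hr e e), smul_apply, hqf,
      inner_smul_right, inner_self_eq_norm_sq_to_K, hf]
    simp
  have hintertwine {T : H →L[ℂ] H} (hT : IsCompactOperator ⇑T) (x : H) : α T (L x) = L (T x) := by
    change α T (α (rankOne ℂ x e) f) = α (rankOne ℂ (T x) e) f
    rw [← comp_rankOne, ← ContinuousLinearMap.mul_def, hmul _ _ hT (hr x e),
      mul_apply_eq_comp]
  have hLsurj : Function.Surjective L := fun k ↦ by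
    obtain ⟨T, hT, hTα⟩ := hsurj _ (isCompactOperator_rankOne k f)
    refine ⟨T e, ?_⟩
    rw [← hintertwine hT, hTα]
    change rankOne ℂ k f (α (rankOne ℂ e e) f) = k
    simp [hqf, hf]
  let U : H ≃ₗᵢ[ℂ] K := .ofSurjective (L.isometryOfInner hinner) hLsurj
  refine ⟨U, fun T hT k ↦ ?_⟩
  obtain ⟨x, rfl⟩ := U.surjective k
  rw [LinearIsometryEquiv.symm_apply_apply]
  exact hintertwine hT x
end

section
/- Let H and K be complex Hilbert spaces, let (U_i) be a net of unitary operators from H to K and U a unitary from H to K such that U_i h → U h in K for every h ∈ H, and let (a_i) be a net of compact operators on H and a a compact operator on H such that ‖a_i − a‖ → 0. Then ‖U_i ∘ a_i ∘ U_i⁻¹ − U ∘ a ∘ U⁻¹‖ → 0 in operator norm. -/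
open Filter Topology ContinuousLinearMap

/-- A uniformly bounded family of operators converging strongly to zero converges to zero in norm
after composition with a compact operator on the right. -/
theorem IsCompactOperator.tendsto_norm_comp_zero {𝕜 E F G ι : Type*} [RCLike 𝕜]
    [NormedAddCommGroup E] [NormedSpace 𝕜 E] [NormedAddCommGroup F] [NormedSpace 𝕜 F]
    [NormedAddCommGroup G] [NormedSpace 𝕜 G] {c : E →L[𝕜] F} (hc : IsCompactOperator c)
    {l : Filter ι} {T : ι → F →L[𝕜] G} {C : ℝ} (hT : ∀ i, ‖T i‖ ≤ C)
    (hT0 : ∀ y, Tendsto (fun i => T i y) l (𝓝 0)) :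
    Tendsto (fun i => ‖(T i).comp c‖) l (𝓝 0) := by
  rw [Metric.tendsto_nhds]
  intro ε hε
  obtain ⟨S, hS, hcS⟩ := hc.image_closedBall_subset_compact (f := (c : E →ₛₗ[.id 𝕜] F)) 1
  set δ : ℝ := ε / (4 * (|C| + 1)) with hδ
  have hδ0 : 0 < δ := by positivity
  obtain ⟨t, ht, hSt⟩ := Metric.totallyBounded_iff.1 hS.totallyBounded δ hδ0
  have hev : ∀ᶠ i in l, ∀ y ∈ t, ‖T i y‖ < ε / 4 :=
    (eventually_all_finite ht).2 fun y _ =>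
      (tendsto_zero_iff_norm_tendsto_zero.1 (hT0 y)).eventually_lt_const (by positivity)
  filter_upwards [hev] with i hi
  rw [Real.dist_0_eq_abs, abs_norm]
  refine lt_of_le_of_lt (opNorm_le_of_unit_norm (by positivity) fun x hx => ?_) (half_lt_self hε)
  have hxS : c x ∈ S := hcS ⟨x, by simp [hx], rfl⟩
  obtain ⟨y, hy, hxy⟩ := Set.mem_iUnion₂.1 (hSt hxS)
  rw [Metric.mem_ball, dist_eq_norm] at hxy
  have hδC : (|C| + 1) * δ = ε / 4 := by
    rw [hδ]
    field_simp
  calc ‖T i (c x)‖ = ‖T i (c x - y) + T i y‖ := by simp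
    _ ≤ ‖T i (c x - y)‖ + ‖T i y‖ := norm_add_le _ _
    _ ≤ (|C| + 1) * δ + ε / 4 := by
        gcongr
        · exact (T i).le_of_opNorm_le_of_le
            ((hT i).trans ((le_abs_self C).trans (lt_add_one _).le)) hxy.le
        · exact (hi y hy).le
    _ = ε / 2 := by rw [hδC]; ring

/-- The adjoints of a uniformly bounded family of operators converging strongly to zero converge to
zero in norm after composition with a compact operator on the left. -/
theorem IsCompactOperator.tendsto_norm_comp_adjoint_zero {𝕜 H K G ι : Type*} [RCLike 𝕜]
    [NormedAddCommGroup H] [InnerProductSpace 𝕜 H] [CompleteSpace H]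
    [NormedAddCommGroup K] [InnerProductSpace 𝕜 K] [CompleteSpace K]
    [NormedAddCommGroup G] [InnerProductSpace 𝕜 G] [CompleteSpace G]
    {a : H →L[𝕜] G} (ha : IsCompactOperator a) {l : Filter ι} {T : ι → H →L[𝕜] K} {C : ℝ}
    (hT : ∀ i, ‖T i‖ ≤ C) (hT0 : ∀ y, Tendsto (fun i => T i y) l (𝓝 0)) :
    Tendsto (fun i => ‖a.comp (adjoint (T i))‖) l (𝓝 0) := by
  have hc : IsCompactOperator ((adjoint a).comp a) := ha.clm_comp (adjoint a)
  have h := ((hc.tendsto_norm_comp_zero hT hT0).mul_const C).sqrt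
  rw [zero_mul, Real.sqrt_zero] at h
  refine squeeze_zero (fun _ => norm_nonneg _) (fun i => Real.le_sqrt_of_sq_le ?_) h
  calc ‖a.comp (adjoint (T i))‖ ^ 2
      = ‖((T i).comp ((adjoint a).comp a)).comp (adjoint (T i))‖ := by
        rw [sq, ← norm_adjoint_comp_self, adjoint_comp, adjoint_adjoint]
        rfl
    _ ≤ ‖(T i).comp ((adjoint a).comp a)‖ * ‖adjoint (T i)‖ := opNorm_comp_le _ _
    _ ≤ ‖(T i).comp ((adjoint a).comp a)‖ * C := by
        gcongr
        rw [LinearIsometryEquiv.norm_map]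
        exact hT i


/-- Conjugation `Ad U : T ↦ U ∘ T ∘ U⁻¹` of an operator on `H` by a unitary
`U : H ≃ₗᵢ[ℂ] K`. -/
noncomputable def adUnitary {H K : Type*}
    [NormedAddCommGroup H] [InnerProductSpace ℂ H]
    [NormedAddCommGroup K] [InnerProductSpace ℂ K]
    (U : H ≃ₗᵢ[ℂ] K) (T : H →L[ℂ] H) : K →L[ℂ] K :=
  (U.toLinearIsometry.toContinuousLinearMap).comp
    (T.comp (U.symm.toLinearIsometry.toContinuousLinearMap))

/-- If a net of unitaries `Uᵢ : H → K` converges strongly (pointwise) to a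
unitary `U`, and a net of compact operators `aᵢ` on `H` converges in operator norm to a
compact operator `a`, then `Uᵢ ∘ aᵢ ∘ Uᵢ⁻¹ → U ∘ a ∘ U⁻¹` in operator norm. -/
theorem ad_continuous_strong_times_norm
    {H K : Type*} [NormedAddCommGroup H] [InnerProductSpace ℂ H] [CompleteSpace H]
    [NormedAddCommGroup K] [InnerProductSpace ℂ K] [CompleteSpace K]
    {ι : Type*} (l : Filter ι)
    (Ui : ι → (H ≃ₗᵢ[ℂ] K)) (U : H ≃ₗᵢ[ℂ] K)
    (hU : ∀ h : H, Filter.Tendsto (fun i => Ui i h) l (nhds (U h)))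
    (ai : ι → (H →L[ℂ] H)) (a : H →L[ℂ] H)
    (hai : ∀ i, IsCompactOperator ⇑(ai i)) (ha : IsCompactOperator ⇑a)
    (hnorm : Filter.Tendsto (fun i => ‖ai i - a‖) l (nhds 0)) :
    Filter.Tendsto (fun i => ‖adUnitary (Ui i) (ai i) - adUnitary U a‖) l (nhds 0) := by
  set V : ι → H →L[ℂ] K := fun i => (Ui i).toLinearIsometry.toContinuousLinearMap
  set V₀ : H →L[ℂ] K := U.toLinearIsometry.toContinuousLinearMap
  set W : ι → K →L[ℂ] H := fun i => (Ui i).symm.toLinearIsometry.toContinuousLinearMap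
  set W₀ : K →L[ℂ] H := U.symm.toLinearIsometry.toContinuousLinearMap
  have hV : ∀ i, ‖V i‖ ≤ 1 := fun i => (Ui i).toLinearIsometry.norm_toContinuousLinearMap_le
  have hV₀ : ‖V₀‖ ≤ 1 := U.toLinearIsometry.norm_toContinuousLinearMap_le
  have hW : ∀ i, ‖W i‖ ≤ 1 := fun i => (Ui i).symm.toLinearIsometry.norm_toContinuousLinearMap_le
  have hadj : ∀ i, adjoint (V i - V₀) = W i - W₀ := fun i => by
    rw [map_sub]
    exact congrArg₂ _ (Ui i).adjoint_eq_symm U.adjoint_eq_symm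
  have hbound : ∀ i, ‖V i - V₀‖ ≤ 1 + 1 := fun i =>
    (norm_sub_le _ _).trans (add_le_add (hV i) hV₀)
  have hzero : ∀ h, Tendsto (fun i => (V i - V₀) h) l (𝓝 0) := fun h =>
    tendsto_sub_nhds_zero_iff.2 (hU h)
  have hleft := ha.tendsto_norm_comp_zero hbound hzero
  have hright := ha.tendsto_norm_comp_adjoint_zero hbound hzero
  simp only [hadj] at hright
  have hsum := (hnorm.add hleft).add hright
  simp only [add_zero] at hsum
  refine squeeze_zero (fun _ => norm_nonneg _) (fun i => ?_) hsum
  have hsplit : adUnitary (Ui i) (ai i) - adUnitary U a =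
      (V i).comp ((ai i - a).comp (W i)) + ((V i - V₀).comp a).comp (W i) +
        V₀.comp (a.comp (W i - W₀)) := by
    ext x
    simp [adUnitary, V, V₀, W, W₀]
  rw [hsplit]
  refine (norm_add₃_le).trans (add_le_add_three ?_ ?_ ?_)
  · refine ((opNorm_comp_le _ _).trans (mul_le_of_le_one_left (norm_nonneg _) (hV i))).trans ?_
    exact (opNorm_comp_le _ _).trans (mul_le_of_le_one_right (norm_nonneg _) (hW i))
  · exact (opNorm_comp_le _ _).trans (mul_le_of_le_one_right (norm_nonneg _) (hW i))
  · exact (opNorm_comp_le _ _).trans (mul_le_of_le_one_left (norm_nonneg _) hV₀)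
end
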